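/- arXiv:1711.06937 — 2 statements merged into one kernel-verified Lean document; each statement's English description precedes it below -/
import Mathlib

section
/- Let n ≥ 4 be an even natural number, let t_min > 0 and h > 0 be reals with h·t_min ≥ t_min, let μ be a Borel probability measure on ℝ supported on [t_min, ∞) with μ((−∞, h·t_min]) ≥ 11/12. Then the product measure μⁿ of the set { t : Fin n → ℝ | SC_M(t) > (2h + 1)·minᵢ tᵢ } is at most (e/(2π))·(1/n). -/
open MeasureTheory Finset
open scoped ENNReal

/-- The expected social cost of Koutsoupias's truthful scheduling mechanism on a
nondecreasingly sorted input `s` (index `⟨0, hn⟩` plays the role of machine 1). -/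
noncomputable def SCM {n : ℕ} (s : Fin n → ℝ) (hn : 0 < n) : ℝ :=
  (∫ y in (0:ℝ)..(s ⟨0, hn⟩),
      ∏ i ∈ Finset.univ.filter (fun i => i ≠ (⟨0, hn⟩ : Fin n)), (1 - y / s i)) +
  ∑ k ∈ Finset.univ.filter (fun k => k ≠ (⟨0, hn⟩ : Fin n)),
    (1 / s ⟨0, hn⟩) *
      ∫ y in (0:ℝ)..(s ⟨0, hn⟩), ∫ x in (0:ℝ)..y,
        ∏ i ∈ Finset.univ.filter (fun i => i ≠ (⟨0, hn⟩ : Fin n) ∧ i ≠ k), (1 - x / s i)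

/-- The expected social cost of the mechanism on a general input `t`: apply `SCM`
to the nondecreasing rearrangement of `t`. -/
noncomputable def SCMgen {n : ℕ} (t : Fin n → ℝ) (hn : 0 < n) : ℝ :=
  SCM (t ∘ Tuple.sort t) hn

theorem integral_one_sub_div_pow_le {H y : ℝ} (hH : 0 < H) (hy : y ≤ H) (j : ℕ) :
    ∫ x in (0 : ℝ)..y, (1 - x / H) ^ j ≤ H / (j + 1) := by
  have hj : (0 : ℝ) < j + 1 := by positivity
  have hd : ∀ x ∈ Set.uIcc (0 : ℝ) y,
      HasDerivAt (fun x : ℝ => -(H / (j + 1)) * (1 - x / H) ^ (j + 1)) ((1 - x / H) ^ j) x := by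
    intro x _
    have h1 : HasDerivAt (fun x : ℝ => 1 - x / H) (-(1 / H)) x := by
      simpa using ((hasDerivAt_id x).div_const H).const_sub 1
    refine ((h1.pow (j + 1)).const_mul (-(H / (j + 1)))).congr_deriv ?_
    simp only [Nat.cast_add, Nat.cast_one, Nat.add_sub_cancel]
    field_simp
  rw [intervalIntegral.integral_eq_sub_of_hasDerivAt hd
    (Continuous.intervalIntegrable (by fun_prop) _ _)]
  have h2 : 0 ≤ H / (j + 1) * (1 - y / H) ^ (j + 1) := by
    have : 0 ≤ 1 - y / H := by
      rw [sub_nonneg, div_le_one hH]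
      exact hy
    positivity
  simp only [zero_div, sub_zero, one_pow]
  linarith

theorem prod_one_sub_div_le_pow {ι : Type*} {s : ι → ℝ} {A B : Finset ι} (hAB : A ⊆ B)
    {a H x : ℝ} (ha : 0 < a) (has : ∀ i, a ≤ s i) (hA : ∀ i ∈ A, s i ≤ H)
    (hx0 : 0 ≤ x) (hxa : x ≤ a) :
    ∏ i ∈ B, (1 - x / s i) ≤ (1 - x / H) ^ A.card := by
  have hs : ∀ i, 0 < s i := fun i => ha.trans_le (has i)
  have hnn : ∀ i, 0 ≤ 1 - x / s i := fun i => by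
    rw [sub_nonneg, div_le_one (hs i)]
    exact hxa.trans (has i)
  have hle : ∀ i, 1 - x / s i ≤ 1 := fun i => by
    have := div_nonneg hx0 (hs i).le
    linarith
  calc ∏ i ∈ B, (1 - x / s i) ≤ ∏ i ∈ A, (1 - x / s i) :=
        Finset.prod_le_prod_of_subset_of_le_one hAB (fun i _ => hnn i) (fun i _ _ => hle i)
    _ ≤ ∏ _i ∈ A, (1 - x / H) := by
        refine Finset.prod_le_prod (fun i _ => hnn i) fun i hi => ?_
        have := div_le_div_of_nonneg_left hx0 (hs i) (hA i hi)
        linarith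
    _ = (1 - x / H) ^ A.card := by rw [Finset.prod_const]

theorem inner_integral_le {ι : Type*} {s : ι → ℝ} {A B : Finset ι} (hAB : A ⊆ B)
    {a H y : ℝ} (ha : 0 < a) (haH : a ≤ H) (has : ∀ i, a ≤ s i) (hA : ∀ i ∈ A, s i ≤ H)
    (hy0 : 0 ≤ y) (hya : y ≤ a) :
    ∫ x in (0 : ℝ)..y, ∏ i ∈ B, (1 - x / s i) ≤ H / (A.card + 1) := by
  refine (intervalIntegral.integral_mono_on hy0 ?_ ?_ fun x hx =>
    prod_one_sub_div_le_pow hAB ha has hA hx.1 (hx.2.trans hya)).trans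
    (integral_one_sub_div_pow_le (ha.trans_le haH) (hya.trans haH) _)
  · exact Continuous.intervalIntegrable (by fun_prop) _ _
  · exact Continuous.intervalIntegrable (by fun_prop) _ _

theorem intervalIntegral_le_mul_of_le {f : ℝ → ℝ} (hf : Continuous f) {a C : ℝ} (ha : 0 ≤ a)
    (h : ∀ y, 0 ≤ y → y ≤ a → f y ≤ C) : ∫ y in (0 : ℝ)..a, f y ≤ a * C := by
  have := intervalIntegral.integral_mono_on ha (hf.intervalIntegrable _ _)
    (intervalIntegrable_const (c := C) (μ := volume)) fun y hy => h y hy.1 hy.2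
  simpa using this

theorem SCM_le_of_card {n : ℕ} (s : Fin n → ℝ) (hn : 0 < n) {h : ℝ} (hh : 1 ≤ h)
    (hs0 : 0 < s ⟨0, hn⟩) (hs : ∀ i, s ⟨0, hn⟩ ≤ s i)
    (hcard : n ≤ 2 * #{i | i ≠ (⟨0, hn⟩ : Fin n) ∧ s i ≤ h * s ⟨0, hn⟩}) :
    SCM s hn ≤ (2 * h + 1) * s ⟨0, hn⟩ := by
  set z : Fin n := ⟨0, hn⟩ with hz
  set a := s z with ha
  set A : Finset (Fin n) := {i | i ≠ z ∧ s i ≤ h * a} with hA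
  have hA0 : (0 : ℝ) < #A := by
    have : 0 < #A := by omega
    exact_mod_cast this
  have haH : a ≤ h * a := le_mul_of_one_le_left hs0.le hh
  have hfirst : ∫ y in (0 : ℝ)..a, ∏ i with i ≠ z, (1 - y / s i) ≤ a * 1 := by
    refine intervalIntegral_le_mul_of_le (by fun_prop) hs0.le fun y hy0 hya => ?_
    simpa using prod_one_sub_div_le_pow (A := ∅) (H := 1) (Finset.empty_subset _) hs0 hs
      (by simp) hy0 hya
  have hterm : ∀ k ∈ Finset.univ.filter (fun k => k ≠ z),
      (1 / a) * ∫ y in (0 : ℝ)..a, ∫ x in (0 : ℝ)..y, ∏ i with i ≠ z ∧ i ≠ k, (1 - x / s i)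
        ≤ h * a / #A := by
    intro k _
    have hcont : Continuous fun y : ℝ =>
        ∫ x in (0 : ℝ)..y, ∏ i with i ≠ z ∧ i ≠ k, (1 - x / s i) :=
      intervalIntegral.continuous_primitive
        (fun _ _ => Continuous.intervalIntegrable (by fun_prop) _ _) 0
    have hint := intervalIntegral_le_mul_of_le (C := h * a / #A) hcont hs0.le
      fun y hy0 hya => by
        refine (inner_integral_le (A := A.erase k) ?_ hs0 haH hs ?_ hy0 hya).trans ?_
        · intro i hi
          simp only [hA, Finset.mem_erase, Finset.mem_filter, Finset.mem_univ, true_and] at hi ⊢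
          exact ⟨hi.2.1, hi.1⟩
        · intro i hi
          simp only [hA, Finset.mem_erase, Finset.mem_filter, Finset.mem_univ, true_and] at hi
          exact hi.2.2
        · refine div_le_div_of_nonneg_left (hs0.le.trans haH) hA0 ?_
          have : #A ≤ #(A.erase k) + 1 := by
            have := Finset.pred_card_le_card_erase (s := A) (a := k)
            omega
          exact_mod_cast this
    calc _ ≤ (1 / a) * (a * (h * a / #A)) := by
          have : 0 ≤ 1 / a := by positivity
          gcongr
      _ = h * a / #A := by field_simp
  have hsum := Finset.sum_le_card_nsmul _ _ _ hterm
  have hk : ((#(Finset.univ.filter (fun k => k ≠ z)) : ℕ) : ℝ) ≤ 2 * #A := by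
    have : #(Finset.univ.filter (fun k => k ≠ z)) ≤ n :=
      (Finset.card_le_univ _).trans (by simp)
    exact_mod_cast this.trans hcard
  have hlast : (#(Finset.univ.filter (fun k => k ≠ z))) • (h * a / #A) ≤ 2 * (h * a) := by
    rw [nsmul_eq_mul]
    calc _ ≤ (2 * #A : ℝ) * (h * a / #A) := by
          have : 0 ≤ h * a / #A := div_nonneg (hs0.le.trans haH) hA0.le
          gcongr
      _ = 2 * (h * a) := by field_simp
  unfold SCM
  linarith

theorem SCMgen_le_of_card {n : ℕ} (t : Fin n → ℝ) (hn : 0 < n) {h c : ℝ} (hh : 1 ≤ h)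
    (hc : 0 < c) (ht : ∀ i, c ≤ t i) (hcard : 2 * #{i | h * c < t i} + 2 ≤ n)
    (hne : (Finset.univ : Finset (Fin n)).Nonempty) :
    SCMgen t hn ≤ (2 * h + 1) * Finset.univ.inf' hne t := by
  set s := t ∘ Tuple.sort t with hs
  set z : Fin n := ⟨0, hn⟩ with hz
  have hmin : ∀ i, s z ≤ s i := fun i =>
    Tuple.monotone_sort t (Fin.mk_le_of_le_val (Nat.zero_le _))
  have hcs : c ≤ s z := ht _
  have hinf : s z ≤ Finset.univ.inf' hne t := by
    refine Finset.le_inf' _ _ fun i _ => ?_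
    simpa [hs] using hmin ((Tuple.sort t).symm i)
  have hperm : #{i | h * c < s i} = #{i | h * c < t i} :=
    Finset.card_bij (fun i _ => Tuple.sort t i) (by simp [hs]) (by simp)
      fun i hi => ⟨(Tuple.sort t).symm i, by simpa [hs] using hi, by simp⟩
  have hsub : (Finset.univ : Finset (Fin n)) ⊆
      insert z (Finset.univ.filter (fun i => h * c < s i) ∪
        Finset.univ.filter (fun i => i ≠ z ∧ s i ≤ h * s z)) := by
    intro i _
    by_cases hi : i = z
    · simp [hi]
    · by_cases hi' : h * c < s i
      · simp [hi']
      · have : s i ≤ h * s z :=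
          (not_lt.mp hi').trans (mul_le_mul_of_nonneg_left hcs (by linarith))
        simp [hi, this]
  have hcount := (Finset.card_le_card hsub).trans (Finset.card_insert_le _ _)
  have hunion := Finset.card_union_le (Finset.univ.filter (fun i => h * c < s i))
    (Finset.univ.filter (fun i => i ≠ z ∧ s i ≤ h * s z))
  rw [Finset.card_univ, Fintype.card_fin] at hcount
  have hcard' : n ≤ 2 * #{i | i ≠ z ∧ s i ≤ h * s z} := by omega
  exact (SCM_le_of_card s hn hh (hc.trans_le hcs) hmin hcard').trans
    (mul_le_mul_of_nonneg_left hinf (by linarith))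

theorem measure_pi_card_le {ι : Type*} [Fintype ι] (μ : Measure ℝ)
    [IsProbabilityMeasure μ] (U : Set ℝ) [DecidablePred (· ∈ U)] (m : ℕ) :
    Measure.pi (fun _ : ι => μ) {t | m ≤ #{i | t i ∈ U}} ≤
      ((Fintype.card ι).choose m : ℝ≥0∞) * μ U ^ m := by
  classical
  have hsub : {t : ι → ℝ | m ≤ #{i | t i ∈ U}} ⊆
      ⋃ S ∈ Finset.powersetCard m (Finset.univ : Finset ι),
        Set.univ.pi (fun i => if i ∈ S then U else Set.univ) := by
    intro t ht
    obtain ⟨S, hS, hSm⟩ := Finset.exists_subset_card_eq ht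
    simp only [Set.mem_iUnion]
    refine ⟨S, by simp [Finset.mem_powersetCard, hSm], fun i _ => ?_⟩
    by_cases hi : i ∈ S
    · simpa [hi] using hS hi
    · simp [hi]
  refine (measure_mono hsub).trans ((measure_biUnion_finset_le _ _).trans ?_)
  have hbox : ∀ S ∈ Finset.powersetCard m (Finset.univ : Finset ι),
      Measure.pi (fun _ : ι => μ) (Set.univ.pi (fun i => if i ∈ S then U else Set.univ))
        = μ U ^ m := by
    intro S hS
    rw [Measure.pi_pi]
    have : ∀ i, μ (if i ∈ S then U else Set.univ) = if i ∈ S then μ U else 1 := fun i => by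
      split_ifs <;> simp
    simp only [this]
    rw [Finset.prod_ite_mem, Finset.univ_inter, Finset.prod_const,
      (Finset.mem_powersetCard.mp hS).2]
  rw [Finset.sum_congr rfl hbox]
  simp

theorem two_mul_centralBinom_le_four_pow {m : ℕ} (hm : 1 ≤ m) :
    2 * m.centralBinom ≤ 4 ^ m := by
  induction m, hm using Nat.le_induction with
  | base => decide
  | succ k _ ih =>
    refine Nat.le_of_mul_le_mul_left ?_ (Nat.succ_pos k)
    have := Nat.succ_mul_centralBinom_succ k
    rw [pow_succ]
    nlinarith

theorem centralBinom_mul_twelfth_pow_le {m : ℕ} (hm : 1 ≤ m) :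
    (m.centralBinom : ℝ) * (1 / 12) ^ m ≤ Real.exp 1 / (2 * Real.pi) * (1 / (m + m : ℕ)) := by
  have h1 : (2 : ℝ) * m.centralBinom ≤ 4 ^ m := by
    exact_mod_cast two_mul_centralBinom_le_four_pow hm
  have h3 : 3 * m ≤ 3 ^ m := by
    induction m, hm using Nat.le_induction with
    | base => simp
    | succ k hk ih =>
      have := ih (by exact_mod_cast two_mul_centralBinom_le_four_pow hk)
      rw [pow_succ]
      omega
  have h3' : (3 : ℝ) * m ≤ 3 ^ m := by exact_mod_cast h3
  have hm0 : (0 : ℝ) < m := by exact_mod_cast hm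
  have he := Real.exp_one_gt_d9
  have hpi := Real.pi_lt_d2
  have hpi0 := Real.pi_pos
  have h12 : (12 : ℝ) ^ m = 4 ^ m * 3 ^ m := by rw [← mul_pow]; norm_num
  calc (m.centralBinom : ℝ) * (1 / 12) ^ m ≤ (4 ^ m / 2) * (1 / 12) ^ m := by
        gcongr
        linarith
    _ = 1 / (2 * 3 ^ m) := by
        rw [one_div_pow, h12]
        field_simp
    _ ≤ 1 / (2 * (3 * m)) := by gcongr
    _ ≤ _ := by
        push_cast
        rw [div_mul_div_comm, div_le_div_iff₀ (by positivity) (by positivity)]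
        nlinarith

theorem prob_cost_exceeds_bound
    (n : ℕ) (hn4 : 4 ≤ n) (hne : Even n) (tmin h : ℝ) (htmin : 0 < tmin) (hh : 0 < h)
    (hht : tmin ≤ h * tmin) (μ : Measure ℝ) [IsProbabilityMeasure μ]
    (hsupp : μ (Set.Ici tmin) = 1)
    (hcdf : (11 / 12 : ℝ≥0∞) ≤ μ (Set.Iic (h * tmin))) :
    Measure.pi (fun _ : Fin n => μ)
        { t : Fin n → ℝ |
          (2 * h + 1) * Finset.univ.inf' ⟨⟨0, by omega⟩, Finset.mem_univ _⟩ t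
            < SCMgen t (by omega) }
      ≤ ENNReal.ofReal (Real.exp 1 / (2 * Real.pi) * (1 / n)) := by
  have hh1 : 1 ≤ h := by
    by_contra! hlt
    nlinarith
  obtain ⟨m, rfl⟩ := hne
  have hnull : Measure.pi (fun _ : Fin (m + m) => μ) {t | ∃ i, t i < tmin} = 0 := by
    have hIio : μ (Set.Iio tmin) = 0 := by
      rw [← Set.compl_Ici]
      exact (prob_compl_eq_zero_iff measurableSet_Ici).mpr hsupp
    rw [Set.ofPred_exists, measure_iUnion_null_iff]
    intro i
    exact (measurePreserving_eval (fun _ : Fin (m + m) => μ) i).quasiMeasurePreserving.preimage_null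
      hIio
  have hIoi : μ (Set.Ioi (h * tmin)) ≤ ENNReal.ofReal (1 / 12) := by
    rw [← Set.compl_Iic, prob_compl_eq_one_sub measurableSet_Iic]
    refine (tsub_le_tsub_left hcdf 1).trans ?_
    rw [show (11 / 12 : ℝ≥0∞) = ENNReal.ofReal (11 / 12) by
      rw [ENNReal.ofReal_div_of_pos (by norm_num)]; norm_num, ← ENNReal.ofReal_one,
      ← ENNReal.ofReal_sub _ (by norm_num)]
    norm_num
  classical
  calc _ ≤ Measure.pi (fun _ : Fin (m + m) => μ)
        ({t | ∃ i, t i < tmin} ∪ {t | m ≤ #{i | t i ∈ Set.Ioi (h * tmin)}}) := by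
        refine measure_mono fun t ht => ?_
        by_contra hcon
        simp only [Set.mem_union, Set.mem_ofPred_eq, not_or, not_exists, not_lt, not_le,
          Set.mem_Ioi] at hcon
        have := SCMgen_le_of_card t (by omega) hh1 htmin hcon.1
          (by have := hcon.2; omega)
          ⟨⟨0, by omega⟩, Finset.mem_univ _⟩
        exact absurd ht (not_lt.mpr this)
    _ ≤ 0 + ((Fintype.card (Fin (m + m))).choose m : ℝ≥0∞) * μ (Set.Ioi (h * tmin)) ^ m :=
        (measure_union_le _ _).trans (add_le_add hnull.le (measure_pi_card_le μ _ m))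
    _ ≤ (m.centralBinom : ℝ≥0∞) * ENNReal.ofReal (1 / 12) ^ m := by
        rw [zero_add, Fintype.card_fin, Nat.centralBinom, two_mul]
        gcongr
    _ = ENNReal.ofReal (m.centralBinom * (1 / 12) ^ m) := by
        rw [ENNReal.ofReal_mul (by positivity), ENNReal.ofReal_pow (by norm_num),
          ENNReal.ofReal_natCast]
    _ ≤ _ := ENNReal.ofReal_le_ofReal (centralBinom_mul_twelfth_pow_le (by omega))
end

section
/- Let n ≥ 4 be an even integer, let h > 0 be a real number, and let t₁, …, tₙ be reals with 0 < t₁ ≤ t₂ ≤ ⋯ ≤ tₙ and t_{n/2} ≤ h·t₁. Then Σ_{k=2}^{n} (1/t₁)·∫₀^{t₁} ∫₀^{y} ∏_{i ∈ {2,…,n}, i ≠ k} (1 − x/tᵢ) dx dy ≤ ((n − 1)/(n − 2))·2h·t₁·(1 + (2h/n)·((1 − 1/h)^{n/2} − 1)). -/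
open MeasureTheory Finset

/-- The contribution of machines 2,…,n to the expected social cost of Koutsoupias's
truthful scheduling mechanism on a nondecreasingly sorted input `s`
(index `⟨0, hn⟩` plays the role of machine 1). -/
noncomputable def SCMtail {n : ℕ} (s : Fin n → ℝ) (hn : 0 < n) : ℝ :=
  ∑ k ∈ Finset.univ.filter (fun k => k ≠ (⟨0, hn⟩ : Fin n)),
    (1 / s ⟨0, hn⟩) *
      ∫ y in (0:ℝ)..(s ⟨0, hn⟩), ∫ x in (0:ℝ)..y,
        ∏ i ∈ Finset.univ.filter (fun i => i ≠ (⟨0, hn⟩ : Fin n) ∧ i ≠ k), (1 - x / s i)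

/-- Antiderivative of `(1 - x / c) ^ p`. -/
lemma integral_one_sub_div_pow (c : ℝ) (hc : c ≠ 0) (p : ℕ) (y : ℝ) :
    ∫ x in (0:ℝ)..y, (1 - x / c) ^ p = c / (p + 1) * (1 - (1 - y / c) ^ (p + 1)) := by
  have hp : (p : ℝ) + 1 ≠ 0 := by positivity
  have hderiv : ∀ x ∈ Set.uIcc 0 y,
      HasDerivAt (fun x : ℝ => -(c / (p + 1)) * (1 - x / c) ^ (p + 1)) ((1 - x / c) ^ p) x := by
    intro x _
    refine (((((hasDerivAt_id' x).div_const c).const_sub 1).fun_pow (p + 1)).const_mul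
      (-(c / ((p : ℝ) + 1)))).congr_deriv ?_
    rw [Nat.add_sub_cancel]
    push_cast
    generalize (1 - x / c) ^ p = z
    field_simp
  rw [intervalIntegral.integral_eq_sub_of_hasDerivAt hderiv
    (Continuous.intervalIntegrable (by fun_prop) _ _)]
  simp
  ring

lemma integral_integral_one_sub_div_pow (c : ℝ) (hc : c ≠ 0) (p : ℕ) (T : ℝ) :
    ∫ y in (0:ℝ)..T, ∫ x in (0:ℝ)..y, (1 - x / c) ^ p =
      c / (p + 1) * (T - c / (p + 2) * (1 - (1 - T / c) ^ (p + 2))) := by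
  simp_rw [integral_one_sub_div_pow c hc]
  rw [intervalIntegral.integral_const_mul, intervalIntegral.integral_sub (by simp)
    (Continuous.intervalIntegrable (by fun_prop) _ _), integral_one_sub_div_pow c hc]
  push_cast
  simp
  left; left; ring

/-- A product of factors `1 - x / t i` is at most `(1 - x / c) ^ p` as soon as `p` of the
`t i` are at most `c`. -/
lemma prod_one_sub_div_le_pow_s14 {ι : Type*} (S A : Finset ι) (hAS : A ⊆ S) (t : ι → ℝ)
    (T c x : ℝ) (p : ℕ) (hp : p ≤ A.card) (hT : 0 < T) (hTt : ∀ i ∈ S, T ≤ t i)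
    (hTc : T ≤ c) (htc : ∀ i ∈ A, t i ≤ c) (hx0 : 0 ≤ x) (hxT : x ≤ T) :
    ∏ i ∈ S, (1 - x / t i) ≤ (1 - x / c) ^ p := by
  have h0 : ∀ i ∈ S, 0 ≤ 1 - x / t i := fun i hi => by
    have := div_le_one_of_le₀ (hxT.trans (hTt i hi)) (hT.le.trans (hTt i hi))
    linarith
  have h1 : ∀ i ∈ S, 1 - x / t i ≤ 1 := fun i hi => by
    have := div_nonneg hx0 (hT.le.trans (hTt i hi))
    linarith
  have hc0 : 0 ≤ 1 - x / c := by
    have := div_le_one_of_le₀ (hxT.trans hTc) (hT.le.trans hTc)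
    linarith
  have hc1 : 1 - x / c ≤ 1 := by
    have := div_nonneg hx0 (hT.le.trans hTc)
    linarith
  calc ∏ i ∈ S, (1 - x / t i) ≤ ∏ i ∈ A, (1 - x / t i) :=
        Finset.prod_le_prod_of_subset_of_le_one hAS h0 fun i hi _ => h1 i hi
    _ ≤ ∏ _i ∈ A, (1 - x / c) := by
        refine Finset.prod_le_prod (fun i hi => h0 i (hAS hi)) fun i hi => ?_
        have : x / c ≤ x / t i :=
          div_le_div_of_nonneg_left hx0 (hT.trans_le (hTt i (hAS hi))) (htc i hi)
        linarith
    _ = (1 - x / c) ^ A.card := by simp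
    _ ≤ (1 - x / c) ^ p := pow_le_pow_of_le_one hc0 hc1 hp

lemma integral_integral_mono {f g : ℝ → ℝ} (hf : Continuous f) (hg : Continuous g) {T : ℝ}
    (hT : 0 ≤ T) (hfg : ∀ x, 0 ≤ x → x ≤ T → f x ≤ g x) :
    ∫ y in (0:ℝ)..T, ∫ x in (0:ℝ)..y, f x ≤ ∫ y in (0:ℝ)..T, ∫ x in (0:ℝ)..y, g x := by
  refine intervalIntegral.integral_mono_on hT
    (Continuous.intervalIntegrable
      (intervalIntegral.continuous_primitive (fun _ _ => hf.intervalIntegrable _ _) 0) _ _)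
    (Continuous.intervalIntegrable
      (intervalIntegral.continuous_primitive (fun _ _ => hg.intervalIntegrable _ _) 0) _ _)
    fun y hy => ?_
  exact intervalIntegral.integral_mono_on hy.1 (hf.intervalIntegrable _ _)
    (hg.intervalIntegrable _ _) fun x hx => hfg x hx.1 (hx.2.trans hy.2)

theorem tail_cost_sharp_bound_under_event_A
    (n : ℕ) (hn4 : 4 ≤ n) (hne : Even n) (h : ℝ) (hh : 0 < h)
    (t : Fin n → ℝ) (hpos : 0 < t ⟨0, by omega⟩) (hmono : Monotone t)
    (hA : t ⟨n / 2 - 1, by omega⟩ ≤ h * t ⟨0, by omega⟩) :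
    SCMtail t (by omega) ≤
      (((n : ℝ) - 1) / ((n : ℝ) - 2)) * (2 * h * t ⟨0, by omega⟩) *
        (1 + (2 * h / (n : ℝ)) * ((1 - 1 / h) ^ (n / 2) - 1)) := by
  obtain ⟨p, hp⟩ : ∃ p, n = 2 * (p + 2) := by
    obtain ⟨m, hm⟩ := hne
    exact ⟨m - 2, by omega⟩
  have hn2 : n / 2 = p + 2 := by omega
  have hn0 : 0 < n := by omega
  unfold SCMtail
  set T := t ⟨0, hn0⟩ with hTdef
  have hTt : ∀ i, T ≤ t i := fun i => hmono (Fin.mk_le_of_le_val (Nat.zero_le _))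
  have hTc : T ≤ h * T := (hTt _).trans hA
  have hc : h * T ≠ 0 := by positivity
  have hterm : ∀ k ∈ univ.filter (fun k => k ≠ (⟨0, hn0⟩ : Fin n)),
      (1 / T) * ∫ y in (0:ℝ)..T, ∫ x in (0:ℝ)..y,
        ∏ i ∈ univ.filter (fun i => i ≠ (⟨0, hn0⟩ : Fin n) ∧ i ≠ k), (1 - x / t i) ≤
      (1 / T) * (h * T / (p + 1) *
        (T - h * T / (p + 2) * (1 - (1 - T / (h * T)) ^ (p + 2)))) := by
    intro k _
    rw [← integral_integral_one_sub_div_pow (h * T) hc p T]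
    refine mul_le_mul_of_nonneg_left ?_ (by positivity)
    refine integral_integral_mono (by fun_prop) (by fun_prop) hpos.le fun x hx0 hxT => ?_
    refine prod_one_sub_div_le_pow_s14 _
      (((Finset.Iic (⟨n / 2 - 1, by omega⟩ : Fin n)).erase ⟨0, hn0⟩).erase k)
      ?_ t T (h * T) x p ?_ hpos (fun i _ => hTt i) hTc ?_ hx0 hxT
    · intro i
      simp only [Finset.mem_erase, Finset.mem_filter, Finset.mem_univ, true_and]
      tauto
    · have h1 := Finset.pred_card_le_card_erase
        (s := (Finset.Iic (⟨n / 2 - 1, by omega⟩ : Fin n)).erase ⟨0, hn0⟩) (a := k)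
      have h2 := Finset.pred_card_le_card_erase
        (s := Finset.Iic (⟨n / 2 - 1, by omega⟩ : Fin n)) (a := ⟨0, hn0⟩)
      rw [Fin.card_Iic] at h2
      simp only at h2
      omega
    · intro i hi
      simp only [Finset.mem_erase, Finset.mem_Iic] at hi
      exact (hmono hi.2.2).trans hA
  refine (Finset.sum_le_card_nsmul _ _ _ hterm).trans (le_of_eq ?_)
  have hcard : ((univ.filter (fun k => k ≠ (⟨0, hn0⟩ : Fin n))).card : ℝ) = 2 * p + 3 := by
    rw [Finset.filter_ne', Finset.card_erase_of_mem (Finset.mem_univ _), Finset.card_univ,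
      Fintype.card_fin, show n - 1 = 2 * p + 3 by omega]
    push_cast
    ring
  have hq : T / (h * T) = 1 / h := by field_simp
  have hnr : (n : ℝ) = 2 * (p + 2) := by
    rw [hp]
    push_cast
    ring
  rw [nsmul_eq_mul, hcard, hq, hn2, hnr]
  generalize (1 - 1 / h) ^ (p + 2) = q
  have h1 : 2 * ((p : ℝ) + 2) - 2 = 2 * (p + 1) := by ring
  rw [h1]
  field_simp
  ring
end
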